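/- arXiv:1612.08362 — 5 statements merged into one kernel-verified Lean document; each statement's English description precedes it below -/
import Mathlib

section
/- Let 𝔤 be a Lie algebra of type 𝒢₁, with nonzero abelian ideal 𝔲 of codimension one and element b ∉ 𝔲, b ⊥ 𝔲, satisfying [b,z] = z for all z ∈ 𝔲. Then a vector X ∈ 𝔤 is orthogonal to the derived algebra [𝔤,𝔤] (equivalently, the left invariant Randers metric defined by the metric and X is of Douglas type) if and only if X ∈ span{b}. -/
/-- If `U` has codimension one and `b ∉ U`, every vector is the sum of an element of `U` and a
multiple of `b`. -/
lemma Submodule.exists_add_smul_eq_of_finrank_eq_add_one {K V : Type*} [Field K]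
    [AddCommGroup V] [Module K V] [Module.Finite K V] {U : Submodule K V}
    (hU : Module.finrank K V = Module.finrank K U + 1) {b : V} (hb : b ∉ U) (x : V) :
    ∃ u ∈ U, ∃ t : K, u + t • b = x := by
  have hlt : U < U ⊔ Submodule.span K {b} := by
    refine lt_of_le_of_ne le_sup_left fun h => hb ?_
    rw [h]
    exact Submodule.mem_sup_right (Submodule.mem_span_singleton_self b)
  have htop : U ⊔ Submodule.span K {b} = ⊤ := by
    apply Submodule.eq_top_of_finrank_eq
    have h₁ := Submodule.finrank_lt_finrank_of_lt hlt
    have h₂ := Submodule.finrank_le (U ⊔ Submodule.span K {b})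
    omega
  obtain ⟨u, hu, v, hv, h⟩ := Submodule.mem_sup.mp (htop ▸ Submodule.mem_top : x ∈ U ⊔ _)
  obtain ⟨t, rfl⟩ := Submodule.mem_span_singleton.mp hv
  exact ⟨u, hu, t, h⟩


/-- Let `𝔤` be a Lie algebra of type `𝒢₁` (Milnor): a finite-dimensional
real Lie algebra with an inner product `g`, containing a nonzero abelian ideal `𝔲` of
codimension one, and an element `b ∉ 𝔲`, orthogonal to `𝔲`, with `[b, z] = z` for all
`z ∈ 𝔲`. Then a vector `X ∈ 𝔤` is orthogonal to the derived algebra `[𝔤, 𝔤]`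
(equivalently, the associated left invariant Randers metric is of Douglas type)
iff `X ∈ span{b}`. -/
theorem randers_douglas_iff_mem_span_b_of_G1
    {𝔤 : Type*} [LieRing 𝔤] [LieAlgebra ℝ 𝔤] [Module.Finite ℝ 𝔤]
    (g : 𝔤 →ₗ[ℝ] 𝔤 →ₗ[ℝ] ℝ)
    (hsymm : ∀ x y : 𝔤, g x y = g y x)
    (hpos : ∀ x : 𝔤, x ≠ 0 → 0 < g x x)
    (𝔲 : Submodule ℝ 𝔤) (h𝔲ne : 𝔲 ≠ ⊥)
    (h𝔲ideal : ∀ x : 𝔤, ∀ u ∈ 𝔲, ⁅x, u⁆ ∈ 𝔲)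
    (h𝔲ab : ∀ u ∈ 𝔲, ∀ w ∈ 𝔲, ⁅u, w⁆ = (0 : 𝔤))
    (hcodim : Module.finrank ℝ 𝔤 = Module.finrank ℝ 𝔲 + 1)
    (b : 𝔤) (hb𝔲 : b ∉ 𝔲)
    (hborth : ∀ u ∈ 𝔲, g b u = 0)
    (hbz : ∀ z ∈ 𝔲, ⁅b, z⁆ = z)
    (X : 𝔤) :
    (∀ y z : 𝔤, g ⁅y, z⁆ X = 0) ↔ X ∈ Submodule.span ℝ ({b} : Set 𝔤) := by
  have hdecomp := Submodule.exists_add_smul_eq_of_finrank_eq_add_one hcodim hb𝔲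
  constructor
  · intro h
    obtain ⟨u, hu, t, rfl⟩ := hdecomp X
    have huu : g u u = 0 := by
      simpa [hbz u hu, hsymm u b, hborth u hu] using h b u
    have hu0 : u = 0 := by
      by_contra hne
      exact (hpos u hne).ne' huu
    rw [hu0, zero_add]
    exact Submodule.smul_mem _ t (Submodule.mem_span_singleton_self b)
  · rintro hX y z
    obtain ⟨c, rfl⟩ := Submodule.mem_span_singleton.mp hX
    obtain ⟨u, hu, t, rfl⟩ := hdecomp y
    obtain ⟨w, hw, s, rfl⟩ := hdecomp z
    have hmem : ⁅u + t • b, w + s • b⁆ ∈ 𝔲 := by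
      have h : ⁅u + t • b, w + s • b⁆ = t • w - s • u := by
        rw [add_lie, lie_add, lie_add, h𝔲ab u hu w hw, lie_smul, ← lie_skew u b, hbz u hu,
          smul_lie, hbz w hw, smul_lie, lie_smul, lie_self]
        module
      rw [h]
      exact 𝔲.sub_mem (𝔲.smul_mem t hw) (𝔲.smul_mem s hu)
    rw [hsymm, map_smul, LinearMap.smul_apply, hborth _ hmem, smul_zero]
end

section
/- Let 𝔤 be a Lie algebra of type 𝒢₁, with nonzero abelian ideal 𝔲 of codimension one and element b ∉ 𝔲, b ⊥ 𝔲, satisfying [b,z] = z for all z ∈ 𝔲. If X ∈ 𝔤 satisfies both Berwald conditions, namely ⟨[y,X],z⟩ + ⟨[z,X],y⟩ = 0 for all y,z ∈ 𝔤 and ⟨[y,z],X⟩ = 0 for all y,z ∈ 𝔤, then X = 0. Hence 𝔤 admits no left invariant non-Riemannian (α,β)-metric of Berwald type. -/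
theorem Submodule.sup_span_singleton_eq_top {K V : Type*} [DivisionRing K] [AddCommGroup V]
    [Module K V] [Module.Finite K V] {W : Submodule K V} {v : V} (hv : v ∉ W)
    (hW : Module.finrank K V = Module.finrank K W + 1) :
    W ⊔ Submodule.span K {v} = ⊤ := by
  have hlt : W < W ⊔ Submodule.span K {v} :=
    left_lt_sup.mpr fun h => hv (h (Submodule.mem_span_singleton_self v))
  apply Submodule.eq_top_of_finrank_eq
  have h₁ := Submodule.finrank_lt_finrank_of_lt hlt
  have h₂ := Submodule.finrank_le (W ⊔ Submodule.span K {v})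
  omega

/-- Let `𝔤` be a Lie algebra of type `𝒢₁` (Milnor): a finite-dimensional
real Lie algebra with an inner product `g`, containing a nonzero abelian ideal `𝔲` of
codimension one, and an element `b ∉ 𝔲`, orthogonal to `𝔲`, with `[b, z] = z` for all
`z ∈ 𝔲`. If `X ∈ 𝔤` satisfies both Berwald conditions, then `X = 0`; hence `𝔤` admits
no left invariant non-Riemannian `(α,β)`-metric of Berwald type. -/
theorem berwald_implies_zero_of_G1
    {𝔤 : Type*} [LieRing 𝔤] [LieAlgebra ℝ 𝔤] [Module.Finite ℝ 𝔤]
    (g : 𝔤 →ₗ[ℝ] 𝔤 →ₗ[ℝ] ℝ)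
    (hsymm : ∀ x y : 𝔤, g x y = g y x)
    (hpos : ∀ x : 𝔤, x ≠ 0 → 0 < g x x)
    (𝔲 : Submodule ℝ 𝔤) (h𝔲ne : 𝔲 ≠ ⊥)
    (h𝔲ideal : ∀ x : 𝔤, ∀ u ∈ 𝔲, ⁅x, u⁆ ∈ 𝔲)
    (h𝔲ab : ∀ u ∈ 𝔲, ∀ w ∈ 𝔲, ⁅u, w⁆ = (0 : 𝔤))
    (hcodim : Module.finrank ℝ 𝔤 = Module.finrank ℝ 𝔲 + 1)
    (b : 𝔤) (hb𝔲 : b ∉ 𝔲)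
    (hborth : ∀ u ∈ 𝔲, g b u = 0)
    (hbz : ∀ z ∈ 𝔲, ⁅b, z⁆ = z)
    (X : 𝔤)
    (hB1 : ∀ y z : 𝔤, g ⁅y, X⁆ z + g ⁅z, X⁆ y = 0)
    (hB2 : ∀ y z : 𝔤, g ⁅y, z⁆ X = 0) :
    X = 0 := by
  have eq_zero_of_self : ∀ x : 𝔤, g x x = 0 → x = 0 := fun x hx => by
    by_contra h
    exact (hpos x h).ne' hx
  obtain ⟨u, hu, v, hv, rfl⟩ := Submodule.mem_sup.mp
    (Submodule.sup_span_singleton_eq_top hb𝔲 hcodim ▸ Submodule.mem_top : X ∈ _)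
  obtain ⟨t, rfl⟩ := Submodule.mem_span_singleton.mp hv
  have hu0 : u = 0 := by
    apply eq_zero_of_self
    simpa [hbz u hu, hsymm u b, hborth u hu] using hB2 b u
  obtain ⟨z, hz, hz0⟩ := Submodule.exists_mem_ne_zero_of_ne_bot h𝔲ne
  have hbracket : ⁅z, b⁆ = -z := by rw [← lie_skew, hbz z hz]
  have ht : t * g z z = 0 := by
    have h := hB1 z z
    simp only [hu0, zero_add, lie_smul, hbracket, map_smul, map_neg, LinearMap.smul_apply,
      LinearMap.neg_apply, smul_eq_mul] at h
    linarith
  have ht0 : t = 0 := (mul_eq_zero.mp ht).resolve_right (hpos z hz0).ne'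
  simp [hu0, ht0]
end

section
/- Let 𝔤 be a Lie algebra of type 𝒢₁, with nonzero abelian ideal 𝔲 of codimension one and element b ∉ 𝔲, b ⊥ 𝔲, satisfying [b,z] = z for all z ∈ 𝔲. Then for every ξ ≠ 0 the vector X = ξb is orthogonal to [𝔤,𝔤] but does not satisfy the Berwald conditions; consequently 𝔤 admits nonzero vectors X orthogonal to [𝔤,𝔤] failing the Berwald conditions (i.e. the corresponding left invariant Randers metrics are of Douglas type but not of Berwald type). -/
/-- A vector outside a subspace of codimension one spans, together with it, the whole space. -/
theorem exists_add_smul_of_finrank_eq_add_one {K V : Type*} [DivisionRing K] [AddCommGroup V]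
    [Module K V] [Module.Finite K V] {U : Submodule K V}
    (hU : Module.finrank K V = Module.finrank K U + 1) {b : V} (hb : b ∉ U) (y : V) :
    ∃ u ∈ U, ∃ c : K, u + c • b = y := by
  have hlt : U < U ⊔ Submodule.span K {b} :=
    left_lt_sup.2 fun h => hb (h (Submodule.mem_span_singleton_self b))
  have htop : U ⊔ Submodule.span K {b} = ⊤ := by
    apply Submodule.eq_top_of_finrank_eq
    have h₁ := Submodule.finrank_lt_finrank_of_lt hlt
    have h₂ := Submodule.finrank_le (U ⊔ Submodule.span K {b})
    omega
  obtain ⟨u, hu, v, hv, huv⟩ := Submodule.mem_sup.1 (htop ▸ Submodule.mem_top : y ∈ _)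
  obtain ⟨c, rfl⟩ := Submodule.mem_span_singleton.1 hv
  exact ⟨u, hu, c, huv⟩

/-- Let `𝔤` be a Lie algebra of type `𝒢₁` (Milnor). Then for every
`ξ ≠ 0` the vector `X = ξ • b` is orthogonal to the derived algebra `[𝔤, 𝔤]` (so the
corresponding left invariant Randers metric is of Douglas type) but fails the Berwald
conditions; consequently there exists a nonzero `X` orthogonal to `[𝔤, 𝔤]` that fails
the Berwald conditions (a non-Berwaldian Randers metric of Douglas type). -/
theorem douglas_not_berwald_of_G1
    {𝔤 : Type*} [LieRing 𝔤] [LieAlgebra ℝ 𝔤] [Module.Finite ℝ 𝔤]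
    (g : 𝔤 →ₗ[ℝ] 𝔤 →ₗ[ℝ] ℝ)
    (hsymm : ∀ x y : 𝔤, g x y = g y x)
    (hpos : ∀ x : 𝔤, x ≠ 0 → 0 < g x x)
    (𝔲 : Submodule ℝ 𝔤) (h𝔲ne : 𝔲 ≠ ⊥)
    (h𝔲ideal : ∀ x : 𝔤, ∀ u ∈ 𝔲, ⁅x, u⁆ ∈ 𝔲)
    (h𝔲ab : ∀ u ∈ 𝔲, ∀ w ∈ 𝔲, ⁅u, w⁆ = (0 : 𝔤))
    (hcodim : Module.finrank ℝ 𝔤 = Module.finrank ℝ 𝔲 + 1)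
    (b : 𝔤) (hb𝔲 : b ∉ 𝔲)
    (hborth : ∀ u ∈ 𝔲, g b u = 0)
    (hbz : ∀ z ∈ 𝔲, ⁅b, z⁆ = z) :
    (∀ ξ : ℝ, ξ ≠ 0 →
      (∀ y z : 𝔤, g ⁅y, z⁆ (ξ • b) = 0) ∧
        ¬((∀ y z : 𝔤, g ⁅y, ξ • b⁆ z + g ⁅z, ξ • b⁆ y = 0) ∧
          (∀ y z : 𝔤, g ⁅y, z⁆ (ξ • b) = 0))) ∧
    (∃ X : 𝔤, X ≠ 0 ∧ (∀ y z : 𝔤, g ⁅y, z⁆ X = 0) ∧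
      ¬((∀ y z : 𝔤, g ⁅y, X⁆ z + g ⁅z, X⁆ y = 0) ∧
        (∀ y z : 𝔤, g ⁅y, z⁆ X = 0))) := by
  have hlie : ∀ y z : 𝔤, ⁅y, z⁆ ∈ 𝔲 := by
    intro y z
    obtain ⟨u, hu, c, rfl⟩ := exists_add_smul_of_finrank_eq_add_one hcodim hb𝔲 y
    obtain ⟨w, hw, d, rfl⟩ := exists_add_smul_of_finrank_eq_add_one hcodim hb𝔲 z
    have h : ⁅u + c • b, w + d • b⁆ = c • w - d • u := by
      rw [add_lie, lie_add, lie_add, h𝔲ab u hu w hw, lie_smul, smul_lie, smul_lie, lie_smul,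
        lie_self, ← lie_skew u b, hbz u hu, hbz w hw]
      module
    rw [h]
    exact 𝔲.sub_mem (𝔲.smul_mem c hw) (𝔲.smul_mem d hu)
  have hdouglas : ∀ (ξ : ℝ) (y z : 𝔤), g ⁅y, z⁆ (ξ • b) = 0 := by
    intro ξ y z
    rw [map_smul, hsymm, hborth _ (hlie y z), smul_zero]
  have hnotBerwald : ∀ ξ : ℝ, ξ ≠ 0 →
      ¬((∀ y z : 𝔤, g ⁅y, ξ • b⁆ z + g ⁅z, ξ • b⁆ y = 0) ∧
        (∀ y z : 𝔤, g ⁅y, z⁆ (ξ • b) = 0)) := by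
    rintro ξ hξ ⟨h, -⟩
    obtain ⟨z, hz, hz0⟩ := 𝔲.exists_mem_ne_zero_of_ne_bot h𝔲ne
    have hzz := h z z
    rw [lie_smul, ← lie_skew, hbz z hz, map_smul, map_neg, LinearMap.smul_apply,
      LinearMap.neg_apply, smul_eq_mul] at hzz
    exact mul_ne_zero hξ (hpos z hz0).ne' (by linarith)
  have hb0 : b ≠ 0 := fun h => hb𝔲 (h ▸ 𝔲.zero_mem)
  exact ⟨fun ξ hξ => ⟨hdouglas ξ, hnotBerwald ξ hξ⟩,
    (1 : ℝ) • b, smul_ne_zero one_ne_zero hb0, hdouglas 1, hnotBerwald 1 one_ne_zero⟩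
end

section
/- Let 𝔤 be a Lie algebra of type 𝒢₂ with unit vector e spanning [𝔤,𝔤], Γ = e^⊥, and associated maps φ and f. Let X ∈ Γ and y = ηe + v with η ∈ ℝ and v ∈ Γ. Then ⟨y, [X, ad*_y y]⟩ = η²⟨f(X),f(v)⟩ − η³φ(f(X)) + η²φ(X)φ(v). -/
/-- Let `𝔤` be a Lie algebra of type `𝒢₂` (Kaiser), with unit vector `e`
spanning `[𝔤, 𝔤]`, `Γ = e^⊥`, the linear map `φ` with `[z, e] = φ(z) • e` for `z ∈ Γ`, and
the skew-adjoint map `f : Γ → Γ` with `[z, w] = ⟨f(z), w⟩ • e` for `z, w ∈ Γ`.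
For `X ∈ Γ`, `y = η • e + v` with `v ∈ Γ`, and `adStar` the adjoint of `ad_y = [y, ·]`
with respect to `g` (i.e. `⟨adStar u, w⟩ = ⟨u, [y, w]⟩`):
`⟨y, [X, adStar y]⟩ = η²⟨f(X), f(v)⟩ − η³φ(f(X)) + η²φ(X)φ(v)`. -/
theorem inner_adStar_of_G2
    {𝔤 : Type*} [LieRing 𝔤] [LieAlgebra ℝ 𝔤] [Module.Finite ℝ 𝔤]
    (g : 𝔤 →ₗ[ℝ] 𝔤 →ₗ[ℝ] ℝ)
    (hsymm : ∀ x y : 𝔤, g x y = g y x)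
    (hpos : ∀ x : 𝔤, x ≠ 0 → 0 < g x x)
    (e : 𝔤) (he : g e e = 1)
    (hderived : Submodule.span ℝ {w : 𝔤 | ∃ x y : 𝔤, w = ⁅x, y⁆} =
      Submodule.span ℝ ({e} : Set 𝔤))
    (φ : 𝔤 →ₗ[ℝ] ℝ) (hφ : ∀ z : 𝔤, g z e = 0 → ⁅z, e⁆ = φ z • e)
    (f : 𝔤 →ₗ[ℝ] 𝔤) (hfΓ : ∀ z : 𝔤, g z e = 0 → g (f z) e = 0)
    (hf : ∀ z w : 𝔤, g z e = 0 → g w e = 0 → ⁅z, w⁆ = g (f z) w • e)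
    (X : 𝔤) (hX : g X e = 0)
    (η : ℝ) (v : 𝔤) (hv : g v e = 0)
    (y : 𝔤) (hy : y = η • e + v)
    (adStar : 𝔤 →ₗ[ℝ] 𝔤)
    (hadStar : ∀ u w : 𝔤, g (adStar u) w = g u ⁅y, w⁆) :
    g y ⁅X, adStar y⁆ =
      η ^ 2 * g (f X) (f v) - η ^ 3 * φ (f X) + η ^ 2 * (φ X * φ v) := by
  have hye : g y e = η := by simp [hy, he, hv]
  have hfX : g (f X) e = 0 := hfΓ X hX
  have hey : ⁅y, e⁆ = φ v • e := by simp [hy, hφ v hv]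
  have hyf : ⁅y, f X⁆ = (g (f v) (f X) - η * φ (f X)) • e := by
    rw [hy, add_lie, smul_lie, ← lie_skew, hφ _ hfX, hf v (f X) hv hfX]
    module
  have hAe : g (adStar y) e = η * φ v := by
    rw [hadStar, hey, map_smul, hye, smul_eq_mul, mul_comm]
  have hAf : g (f X) (adStar y) = η * (g (f X) (f v) - η * φ (f X)) := by
    rw [hsymm, hadStar, hyf, map_smul, hye, smul_eq_mul, hsymm (f v), mul_comm]
  have hA₀ : g (adStar y - (η * φ v) • e) e = 0 := by simp [hAe, he]
  have hXA : ⁅X, adStar y⁆ = (η * φ v * φ X + g (f X) (adStar y)) • e := by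
    have h := hf X _ hX hA₀
    rw [lie_sub, lie_smul, hφ X hX, map_sub, map_smul, hfX, smul_zero, sub_zero,
      sub_eq_iff_eq_add] at h
    rw [h]
    module
  rw [hXA, map_smul, hye, hAf, smul_eq_mul]
  ring
end

section
/- Let 𝔤 be a finite-dimensional real Lie algebra with inner product ⟨·,·⟩ and let X ∈ 𝔤 with ‖X‖ < 1/2 satisfy the Berwald conditions. Let F be the Matsumoto metric F(u) = ⟨u,u⟩/(√⟨u,u⟩ − ⟨X,u⟩) and g_y its fundamental tensor. Let y, v ∈ 𝔤 be orthonormal and set R_y(v) = ∇_v∇_y y − ∇_y∇_v y − ∇_{[v,y]}y with ∇ the Levi-Civita product. Then the flag curvature satisfies g_y(R_y(v),v) / (g_y(y,y)g_y(v,v) − g_y(y,v)²) = ((2 − F(y)) / (F(y)²(2F(y)²⟨X,v⟩² + 2 − F(y)))) · ⟨R_y(v),v⟩. -/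
/-- The Matsumoto metric `F(u) = ⟨u,u⟩ / (√⟨u,u⟩ − ⟨X,u⟩)` associated with an inner
product (given as a bilinear form `g`) and a vector `X`. -/
noncomputable def matsumotoMetric {𝔤 : Type*} [AddCommGroup 𝔤] [Module ℝ 𝔤]
    (g : 𝔤 →ₗ[ℝ] 𝔤 →ₗ[ℝ] ℝ) (X : 𝔤) (u : 𝔤) : ℝ :=
  g u u / (Real.sqrt (g u u) - g X u)

/-- The fundamental tensor of a Finsler norm `F` at `y`:
`g_y(u,w) = (1/2) ∂²/∂s∂t [F(y + s u + t w)²]` at `s = t = 0`. -/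
noncomputable def fundamentalTensor {𝔤 : Type*} [AddCommGroup 𝔤] [Module ℝ 𝔤]
    (F : 𝔤 → ℝ) (y u w : 𝔤) : ℝ :=
  (1 / 2) * deriv (fun s : ℝ => deriv (fun t : ℝ => (F (y + s • u + t • w)) ^ 2) 0) 0

/-- The directional derivative of the squared Matsumoto metric, as a function of the quadratic
form `A` and the linear form `B` at the base point and of their pairings `P`, `Q` with the
direction. -/
noncomputable def matsumotoSqDeriv (A B P Q : ℝ) : ℝ :=
  2 * (A / (Real.sqrt A - B)) *
    ((2 * P * (Real.sqrt A - B) - A * (P / Real.sqrt A - Q)) / (Real.sqrt A - B) ^ 2)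

section FundamentalTensor

variable {𝔤 : Type*} [AddCommGroup 𝔤] [Module ℝ 𝔤] (g : 𝔤 →ₗ[ℝ] 𝔤 →ₗ[ℝ] ℝ)

lemma hasDerivAt_quadratic_line (hsymm : ∀ x y : 𝔤, g x y = g y x) (p w : 𝔤) :
    HasDerivAt (fun t : ℝ => g (p + t • w) (p + t • w)) (2 * g p w) 0 := by
  have h : (fun t : ℝ => g (p + t • w) (p + t • w)) =
      fun t : ℝ => g p p + t * (2 * g p w) + t ^ 2 * g w w := by
    funext t
    simp only [map_add, map_smul, LinearMap.add_apply, LinearMap.smul_apply, smul_eq_mul,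
      hsymm w p]
    ring
  rw [h]
  refine ((((hasDerivAt_id (0 : ℝ)).mul_const (2 * g p w)).const_add (g p p)).add
    (((hasDerivAt_id (0 : ℝ)).pow 2).mul_const (g w w))).congr_deriv ?_
  simp

lemma hasDerivAt_linear_line (f : 𝔤 →ₗ[ℝ] ℝ) (p w : 𝔤) :
    HasDerivAt (fun t : ℝ => f (p + t • w)) (f w) 0 := by
  simp only [map_add, map_smul, smul_eq_mul]
  simpa using ((hasDerivAt_id (0 : ℝ)).mul_const (f w)).const_add (f p)

lemma hasDerivAt_matsumotoMetric_sq (hsymm : ∀ x y : 𝔤, g x y = g y x) (X p w : 𝔤)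
    (hp : 0 < g p p) (hD : Real.sqrt (g p p) - g X p ≠ 0) :
    HasDerivAt (fun t : ℝ => (matsumotoMetric g X (p + t • w)) ^ 2)
      (matsumotoSqDeriv (g p p) (g X p) (g p w) (g X w)) 0 := by
  have hA := hasDerivAt_quadratic_line g hsymm p w
  have hS := hA.sqrt (by simpa using hp.ne')
  have hF := (hA.div (hS.sub (hasDerivAt_linear_line (g X) p w)) (by simpa using hD)).pow 2
  refine hF.congr_deriv ?_
  simp [matsumotoSqDeriv, mul_div_mul_left]

/-- The fundamental tensor of the Matsumoto metric at a unit vector `y`. -/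
lemma fundamentalTensor_matsumotoMetric (hsymm : ∀ x y : 𝔤, g x y = g y x) (X y u w : 𝔤)
    (hy : g y y = 1) (hD : 1 - g X y ≠ 0) :
    fundamentalTensor (matsumotoMetric g X) y u w =
      (2 * g y u / (1 - g X y) - (g y u - g X u) / (1 - g X y) ^ 2) *
        (2 * g y w / (1 - g X y) - (g y w - g X w) / (1 - g X y) ^ 2) +
      1 / (1 - g X y) *
        (2 * g u w / (1 - g X y) - 2 * g y u * (g y w - g X w) / (1 - g X y) ^ 2 -
          2 * g y w * (g y u - g X u) / (1 - g X y) ^ 2 -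
          (g u w - g y u * g y w) / (1 - g X y) ^ 2 +
          2 * (g y u - g X u) * (g y w - g X w) / (1 - g X y) ^ 3) := by
  have hA := hasDerivAt_quadratic_line g hsymm y u
  have hB := hasDerivAt_linear_line (g X) y u
  have hP : HasDerivAt (fun s : ℝ => g (y + s • u) w) (g u w) 0 :=
    hasDerivAt_linear_line (g.flip w) y u
  have hS := hA.sqrt (by simp [hy])
  have hpos : ∀ᶠ s : ℝ in nhds 0, 0 < g (y + s • u) (y + s • u) :=
    hA.continuousAt.eventually_const_lt (by simp [hy])
  have hne : ∀ᶠ s : ℝ in nhds 0,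
      Real.sqrt (g (y + s • u) (y + s • u)) - g X (y + s • u) ≠ 0 :=
    (hS.sub hB).continuousAt.eventually_ne (by simpa [hy] using hD)
  have hev : (fun s : ℝ => deriv (fun t : ℝ =>
      (matsumotoMetric g X (y + s • u + t • w)) ^ 2) 0) =ᶠ[nhds 0]
      fun s : ℝ => matsumotoSqDeriv (g (y + s • u) (y + s • u)) (g X (y + s • u))
        (g (y + s • u) w) (g X w) := by
    filter_upwards [hpos, hne] with s h1 h2
    exact (hasDerivAt_matsumotoMetric_sq g hsymm X (y + s • u) w h1 h2).deriv
  have hSB := hS.sub hB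
  have hD0 : Real.sqrt (g (y + (0 : ℝ) • u) (y + (0 : ℝ) • u)) - g X (y + (0 : ℝ) • u) ≠ 0 := by
    simpa [hy] using hD
  have hG := ((hA.div hSB hD0).const_mul 2).mul
    ((((hP.const_mul 2).mul hSB).sub
      (hA.mul ((hP.div hS (by simp [hy])).sub_const (g X w)))).div (hSB.pow 2)
        (pow_ne_zero 2 hD0))
  rw [fundamentalTensor, hev.deriv_eq]
  refine (congrArg (fun r => 1 / 2 * r) hG.deriv).trans ?_
  simp [hy]
  field_simp
  ring

end FundamentalTensor

lemma inner_lt_one_of_norm_lt_half {𝔤 : Type*} [AddCommGroup 𝔤] [Module ℝ 𝔤]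
    (g : 𝔤 →ₗ[ℝ] 𝔤 →ₗ[ℝ] ℝ) (hsymm : ∀ x y : 𝔤, g x y = g y x)
    (hpos : ∀ x : 𝔤, x ≠ 0 → 0 < g x x) (X y : 𝔤) (hX : Real.sqrt (g X X) < 1 / 2)
    (hy : g y y = 1) : g X y < 1 := by
  have h0 : 0 ≤ g (X - g X y • y) (X - g X y • y) := by
    by_cases h : X - g X y • y = 0
    · simp [h]
    · exact (hpos _ h).le
  have h1 : g X X < (1 / 2) ^ 2 := (Real.sqrt_lt' (by norm_num)).1 hX
  simp only [map_sub, map_smul, LinearMap.sub_apply, LinearMap.smul_apply, smul_eq_mul,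
    hsymm y X, hy] at h0
  nlinarith

section LeviCivita

variable {𝔤 : Type*} [LieRing 𝔤] [LieAlgebra ℝ 𝔤] {g : 𝔤 →ₗ[ℝ] 𝔤 →ₗ[ℝ] ℝ}
  {nabla : 𝔤 →ₗ[ℝ] 𝔤 →ₗ[ℝ] 𝔤}

lemma leviCivita_metric_compatible
    (hLC : ∀ x y z : 𝔤, 2 * g (nabla x y) z = g ⁅x, y⁆ z - g ⁅y, z⁆ x + g ⁅z, x⁆ y)
    (x y z : 𝔤) : g (nabla x y) z = -g (nabla x z) y := by
  have h1 := hLC x y z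
  have h2 := hLC x z y
  rw [← lie_skew z x, ← lie_skew y z, ← lie_skew x y] at h1
  simp only [map_neg, LinearMap.neg_apply] at h1
  linarith

lemma leviCivita_inner_eq_zero
    (hLC : ∀ x y z : 𝔤, 2 * g (nabla x y) z = g ⁅x, y⁆ z - g ⁅y, z⁆ x + g ⁅z, x⁆ y)
    {X : 𝔤} (hB1 : ∀ y z : 𝔤, g ⁅y, X⁆ z + g ⁅z, X⁆ y = 0)
    (hB2 : ∀ y z : 𝔤, g ⁅y, z⁆ X = 0) (x y : 𝔤) : g (nabla x y) X = 0 := by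
  have h1 := hLC x y X
  have h2 := hB1 x y
  rw [hB2, ← lie_skew X x] at h1
  simp only [map_neg, LinearMap.neg_apply] at h1
  linarith

end LeviCivita

/-- Flag curvature of a left invariant Matsumoto metric of Berwald type:
for a metric Lie algebra `(𝔤, g)`, `X` with `‖X‖ < 1/2` satisfying the Berwald conditions,
the Levi-Civita product `∇` (`nabla`), orthonormal `y, v`, and
`R_y(v) = ∇_v ∇_y y − ∇_y ∇_v y − ∇_{[v,y]} y`, one has
`g_y(R_y(v),v) / (g_y(y,y) g_y(v,v) − g_y(y,v)²)
  = ((2 − F(y)) / (F(y)² (2 F(y)² ⟨X,v⟩² + 2 − F(y)))) ⟨R_y(v), v⟩`. -/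
theorem matsumoto_berwald_flag_curvature
    {𝔤 : Type*} [LieRing 𝔤] [LieAlgebra ℝ 𝔤] [Module.Finite ℝ 𝔤]
    (g : 𝔤 →ₗ[ℝ] 𝔤 →ₗ[ℝ] ℝ)
    (hsymm : ∀ x y : 𝔤, g x y = g y x)
    (hpos : ∀ x : 𝔤, x ≠ 0 → 0 < g x x)
    (X : 𝔤) (hX : Real.sqrt (g X X) < 1 / 2)
    (hB1 : ∀ y z : 𝔤, g ⁅y, X⁆ z + g ⁅z, X⁆ y = 0)
    (hB2 : ∀ y z : 𝔤, g ⁅y, z⁆ X = 0)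
    (nabla : 𝔤 →ₗ[ℝ] 𝔤 →ₗ[ℝ] 𝔤)
    (hLC : ∀ x y z : 𝔤, 2 * g (nabla x y) z = g ⁅x, y⁆ z - g ⁅y, z⁆ x + g ⁅z, x⁆ y)
    (y v : 𝔤) (hy : g y y = 1) (hv : g v v = 1) (hyv : g y v = 0)
    (R : 𝔤) (hR : R = nabla v (nabla y y) - nabla y (nabla v y) - nabla ⁅v, y⁆ y) :
    fundamentalTensor (matsumotoMetric g X) y R v /
        (fundamentalTensor (matsumotoMetric g X) y y y *
            fundamentalTensor (matsumotoMetric g X) y v v -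
          (fundamentalTensor (matsumotoMetric g X) y y v) ^ 2) =
      ((2 - matsumotoMetric g X y) /
          ((matsumotoMetric g X y) ^ 2 *
            (2 * (matsumotoMetric g X y) ^ 2 * (g X v) ^ 2 +
              2 - matsumotoMetric g X y))) *
        g R v := by
  have hlt := inner_lt_one_of_norm_lt_half g hsymm hpos X y hX hy
  have hD : 1 - g X y ≠ 0 := by linarith
  have hcompat := leviCivita_metric_compatible hLC
  have hpar := leviCivita_inner_eq_zero hLC hB1 hB2
  have hRX : g X R = 0 := by
    rw [hsymm, hR]
    simp [hpar]
  have hRy : g y R = 0 := by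
    have h1 := hcompat v (nabla y y) y
    have h2 := hcompat y (nabla v y) y
    have h3 := hcompat ⁅v, y⁆ y y
    have h4 := hsymm (nabla v y) (nabla y y)
    rw [hsymm, hR]
    simp only [map_sub, LinearMap.sub_apply]
    linarith
  have hF : matsumotoMetric g X y = 1 / (1 - g X y) := by simp [matsumotoMetric, hy]
  set D := 1 - g X y with hDdef
  set F := matsumotoMetric g X y with hFdef
  have hF0 : F ≠ 0 := by rw [hF]; exact one_div_ne_zero hD
  have hb : g X y = 1 - D := by rw [hDdef]; ring
  have hDF : D = 1 / F := by rw [hF, one_div_one_div]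
  have hRv : fundamentalTensor (matsumotoMetric g X) y R v = F ^ 2 * (2 - F) * g R v := by
    rw [fundamentalTensor_matsumotoMetric g hsymm X y R v hy hD, ← hDdef, hRy, hRX, hyv, hDF]
    field_simp
    ring
  have hyy : fundamentalTensor (matsumotoMetric g X) y y y = F ^ 2 := by
    rw [fundamentalTensor_matsumotoMetric g hsymm X y y y hy hD, ← hDdef, hy, hb, hDF]
    field_simp
    ring
  have hyv' : fundamentalTensor (matsumotoMetric g X) y y v = F ^ 3 * g X v := by
    rw [fundamentalTensor_matsumotoMetric g hsymm X y y v hy hD, ← hDdef, hy, hyv, hb, hDF]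
    field_simp
    ring
  have hvv : fundamentalTensor (matsumotoMetric g X) y v v =
      F ^ 2 * (2 - F + 3 * F ^ 2 * g X v ^ 2) := by
    rw [fundamentalTensor_matsumotoMetric g hsymm X y v v hy hD, ← hDdef, hyv, hv, hDF]
    field_simp
    ring
  have hdet : F ^ 2 * (F ^ 2 * (2 - F + 3 * F ^ 2 * g X v ^ 2)) - (F ^ 3 * g X v) ^ 2 =
      F ^ 2 * (F ^ 2 * (2 * F ^ 2 * g X v ^ 2 + 2 - F)) := by ring
  rw [hRv, hyy, hyv', hvv, hdet, mul_assoc, mul_div_mul_left _ _ (pow_ne_zero 2 hF0),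
    div_mul_eq_mul_div]
end
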